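/- Let R > 0, d = 7, and let f : [R, ∞) → ℝ be continuously differentiable with ∫_R^∞ |f'(r)|² r⁶ dr < ∞, ∫_R^∞ |f(r)| r dr < ∞, and f(r) → 0 as r → ∞. With f₀ = r^{−5}, f₁ = r^{−3} in Ẇ := span{f₀, f₁} ⊂ Ḣ¹(r ≥ R; r⁶ dr) (inner product ⟨g,h⟩ = ∫_R^∞ g'(r) h'(r) r⁶ dr), the norm of the orthogonal projection of f onto Ẇ^⊥ satisfies ‖π_{Ẇ}^⊥ f‖² = ∫_R^∞ |f'(r)|² r⁶ dr − 5 |f(R)|² R⁵ − R · |3∫_R^∞ f(r) r dr − f(R) R²|². -/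

import Mathlib

open MeasureTheory Set Filter Topology

theorem zpow_neg_natCast_eq_rpow {x : ℝ} (n : ℕ) : x ^ (-(n : ℤ)) = x ^ (-(n : ℝ)) := by
  rw [← Real.rpow_intCast]
  push_cast
  rfl

theorem integrableOn_Ioi_zpow_neg {a : ℝ} (ha : 0 < a) {n : ℕ} (hn : 2 ≤ n) :
    IntegrableOn (fun x : ℝ => x ^ (-(n : ℤ))) (Ioi a) := by
  have h2 : (2 : ℝ) ≤ n := by exact_mod_cast hn
  simp only [zpow_neg_natCast_eq_rpow]
  exact integrableOn_Ioi_rpow_of_lt (by linarith) ha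

theorem integral_Ioi_zpow_neg {a : ℝ} (ha : 0 < a) (n : ℕ) (hn : 1 ≤ n) :
    ∫ x in Ioi a, x ^ (-((n + 1 : ℕ) : ℤ)) = 1 / (n * a ^ n) := by
  have h1 : (1 : ℝ) ≤ n := by exact_mod_cast hn
  simp only [zpow_neg_natCast_eq_rpow]
  rw [integral_Ioi_rpow_of_lt (by push_cast; linarith) ha]
  have h : -((n + 1 : ℕ) : ℝ) + 1 = -(n : ℝ) := by push_cast; ring
  rw [h, Real.rpow_neg ha.le, Real.rpow_natCast]
  field_simp

theorem tendsto_integral_Ioi_atTop_zero {a : ℝ} {h : ℝ → ℝ} (hh : IntegrableOn h (Ioi a)) :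
    Tendsto (fun r => ∫ x in Ioi r, h x) atTop (𝓝 0) := by
  have hlim := (intervalIntegral_tendsto_integral_Ioi a hh tendsto_id).const_sub
    (∫ x in Ioi a, h x)
  rw [sub_self] at hlim
  refine hlim.congr' ?_
  filter_upwards [eventually_ge_atTop a] with r hr
  rw [id, ← intervalIntegral.integral_Ioi_sub_Ioi hh hr]
  ring

/-- If `f` vanishes at infinity and `x ^ n * f'` is integrable, then `x ^ n * f` vanishes at
infinity as well. -/
theorem tendsto_mul_pow_atTop_zero {a : ℝ} (ha : 0 < a) {f f' : ℝ → ℝ} (n : ℕ)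
    (hderiv : ∀ r ∈ Ici a, HasDerivAt f (f' r) r) (hf' : IntegrableOn f' (Ioi a))
    (hf'n : IntegrableOn (fun r => f' r * r ^ n) (Ioi a)) (hlim : Tendsto f atTop (𝓝 0)) :
    Tendsto (fun r => f r * r ^ n) atTop (𝓝 0) := by
  refine squeeze_zero_norm' ?_ (tendsto_integral_Ioi_atTop_zero hf'n.norm)
  filter_upwards [eventually_ge_atTop a] with r hr
  have hr0 : 0 < r := ha.trans_le hr
  have hsub : Ioi r ⊆ Ioi a := Ioi_subset_Ioi hr
  have hFTC := integral_Ioi_of_hasDerivAt_of_tendsto'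
    (fun x hx => hderiv x (le_trans hr hx)) (hf'.mono_set hsub) hlim
  have hf : f r * r ^ n = -∫ x in Ioi r, f' x * r ^ n := by
    rw [integral_mul_const, hFTC]
    ring
  rw [hf, norm_neg]
  refine (norm_integral_le_integral_norm _).trans ?_
  refine setIntegral_mono_on ((hf'.mono_set hsub).mul_const _).norm (hf'n.mono_set hsub).norm
    measurableSet_Ioi fun x hx => ?_
  have hrx : r ≤ x := le_of_lt hx
  have hx0 : 0 ≤ x := hr0.le.trans hrx
  rw [norm_mul, norm_mul, Real.norm_of_nonneg (pow_nonneg hr0.le n),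
    Real.norm_of_nonneg (pow_nonneg hx0 n)]
  gcongr

theorem integrableOn_Ioi_mul_pow_of_sq {a : ℝ} (ha : 0 < a) {g : ℝ → ℝ} (k : ℕ) {m n : ℕ}
    (hn : 2 ≤ n) (hkm : 2 * k + n = m) (hg : ContinuousOn g (Ici a))
    (hint : IntegrableOn (fun r => g r ^ 2 * r ^ m) (Ioi a)) :
    IntegrableOn (fun r => g r * r ^ k) (Ioi a) := by
  have hmeas : AEStronglyMeasurable (fun r => g r * r ^ k) (volume.restrict (Ioi a)) :=
    ((hg.mono Ioi_subset_Ici_self).mul (by fun_prop)).aestronglyMeasurable measurableSet_Ioi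
  refine (hint.add (integrableOn_Ioi_zpow_neg ha hn)).mono' hmeas ?_
  refine (ae_restrict_mem measurableSet_Ioi).mono fun x hx => ?_
  have hx0 : 0 < x := ha.trans hx
  have hxn : 0 < x ^ n := pow_pos hx0 n
  simp only [Pi.add_apply, zpow_neg, zpow_natCast]
  rw [← hkm, Real.norm_eq_abs]
  have key : g x ^ 2 * x ^ (2 * k + n) + (x ^ n)⁻¹ =
      ((g x * x ^ k) ^ 2 * (x ^ n) ^ 2 + 1) * (x ^ n)⁻¹ := by
    field_simp
    ring
  rw [key, ← div_eq_mul_inv, le_div_iff₀ hxn]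
  rw [← sq_abs (g x * x ^ k)]
  nlinarith [sq_nonneg (|g x * x ^ k| * x ^ n - 1), abs_nonneg (g x * x ^ k),
    mul_nonneg (abs_nonneg (g x * x ^ k)) hxn.le]

/-- The squared weighted distance to a linear combination of `r ^ (-5)` and `r ^ (-3)`, expanded
as a quadratic polynomial in the coefficients. -/
theorem integral_sub_sq_mul_pow_six {a : ℝ} (ha : 0 < a) {g : ℝ → ℝ}
    (hg : IntegrableOn g (Ioi a)) (hg2 : IntegrableOn (fun r => g r * r ^ 2) (Ioi a))
    (hint : IntegrableOn (fun r => g r ^ 2 * r ^ 6) (Ioi a)) (c d : ℝ) :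
    ∫ r in Ioi a, (g r - (c * (-5 * r ^ (-6 : ℤ)) + d * (-3 * r ^ (-4 : ℤ)))) ^ 2 * r ^ 6 =
      (∫ r in Ioi a, g r ^ 2 * r ^ 6) + 10 * c * (∫ r in Ioi a, g r) +
        6 * d * (∫ r in Ioi a, g r * r ^ 2) +
        5 * c ^ 2 / a ^ 5 + 10 * c * d / a ^ 3 + 9 * d ^ 2 / a := by
  have hpt : ∀ r ∈ Ioi a,
      (g r - (c * (-5 * r ^ (-6 : ℤ)) + d * (-3 * r ^ (-4 : ℤ)))) ^ 2 * r ^ 6 =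
        g r ^ 2 * r ^ 6 + 10 * c * g r + 6 * d * (g r * r ^ 2) +
          25 * c ^ 2 * r ^ (-((5 + 1 : ℕ) : ℤ)) + 30 * c * d * r ^ (-((3 + 1 : ℕ) : ℤ)) +
          9 * d ^ 2 * r ^ (-((1 + 1 : ℕ) : ℤ)) := by
    intro r hr
    have hr0 : r ≠ 0 := (ha.trans hr).ne'
    have h6 : r ^ (-6 : ℤ) = (r ^ 6)⁻¹ := by rw [zpow_neg]; norm_cast
    have h4 : r ^ (-4 : ℤ) = (r ^ 4)⁻¹ := by rw [zpow_neg]; norm_cast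
    simp only [zpow_neg, zpow_natCast, h6, h4]
    field_simp
    ring
  have h6 := integrableOn_Ioi_zpow_neg ha (n := 5 + 1) (by norm_num)
  have h4 := integrableOn_Ioi_zpow_neg ha (n := 3 + 1) (by norm_num)
  have h2 := integrableOn_Ioi_zpow_neg ha (n := 1 + 1) (by norm_num)
  have i1 := Integrable.fun_add hint (hg.const_mul (10 * c))
  have i2 := Integrable.fun_add i1 (hg2.const_mul (6 * d))
  have i3 := Integrable.fun_add i2 (h6.const_mul (25 * c ^ 2))
  have i4 := Integrable.fun_add i3 (h4.const_mul (30 * c * d))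
  rw [setIntegral_congr_fun measurableSet_Ioi hpt,
    integral_add i4 (h2.const_mul (9 * d ^ 2)), integral_add i3 (h4.const_mul _),
    integral_add i2 (h6.const_mul _), integral_add i1 (hg2.const_mul _),
    integral_add hint (hg.const_mul _)]
  simp only [integral_const_mul]
  rw [integral_Ioi_zpow_neg ha 5 (by norm_num), integral_Ioi_zpow_neg ha 3 (by norm_num),
    integral_Ioi_zpow_neg ha 1 le_rfl]
  push_cast
  field_simp
  ring

/-- d = 7 projection computation: the squared distance in Ḣ¹(r ≥ R; r⁶dr) from f to
span{r^{−5}, r^{−3}} equals ∫_R^∞ |f'|² r⁶ dr − 5|f(R)|²R⁵ − R|3∫_R^∞ f r dr − f(R)R²|². -/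
theorem proj_formula_d7 (R : ℝ) (hR : 0 < R) (f f' : ℝ → ℝ)
    (hderiv : ∀ r ∈ Set.Ici R, HasDerivAt f (f' r) r)
    (hcont : ContinuousOn f' (Set.Ici R))
    (hint : IntegrableOn (fun r => f' r ^ 2 * r ^ 6) (Set.Ioi R))
    (hint2 : IntegrableOn (fun r => |f r| * r) (Set.Ioi R))
    (hlim : Tendsto f atTop (𝓝 0)) :
    (⨅ c : ℝ × ℝ,
        ∫ r in Set.Ioi R,
          (f' r - (c.1 * (-5 * r ^ (-6 : ℤ)) + c.2 * (-3 * r ^ (-4 : ℤ)))) ^ 2 * r ^ 6)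
      = (∫ r in Set.Ioi R, f' r ^ 2 * r ^ 6) - 5 * f R ^ 2 * R ^ 5 -
          R * (3 * (∫ r in Set.Ioi R, f r * r) - f R * R ^ 2) ^ 2 := by
  have hf'0 : IntegrableOn f' (Ioi R) := by
    simpa using integrableOn_Ioi_mul_pow_of_sq hR 0 (n := 6) (by norm_num) rfl hcont hint
  have hf'2 : IntegrableOn (fun r => f' r * r ^ 2) (Ioi R) :=
    integrableOn_Ioi_mul_pow_of_sq hR 2 (n := 2) le_rfl rfl hcont hint
  have hfcont : ContinuousOn f (Ici R) := fun r hr => (hderiv r hr).continuousAt.continuousWithinAt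
  have hfr : IntegrableOn (fun r => f r * r) (Ioi R) := by
    refine hint2.mono' (((hfcont.mono Ioi_subset_Ici_self).mul
      (by fun_prop)).aestronglyMeasurable measurableSet_Ioi) ?_
    refine (ae_restrict_mem measurableSet_Ioi).mono fun x hx => ?_
    rw [norm_mul, Real.norm_eq_abs, Real.norm_of_nonneg (hR.trans hx).le]
  have hI0 : ∫ r in Ioi R, f' r = -f R := by
    rw [integral_Ioi_of_hasDerivAt_of_tendsto' hderiv hf'0 hlim, zero_sub]
  have hI2 : ∫ r in Ioi R, f' r * r ^ 2 = -(f R * R ^ 2) - 2 * ∫ r in Ioi R, f r * r := by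
    have hd : ∀ r ∈ Ici R,
        HasDerivAt (fun r => f r * r ^ 2) (f' r * r ^ 2 + 2 * (f r * r)) r := fun r hr => by
      refine ((hderiv r hr).mul (hasDerivAt_pow 2 r)).congr_deriv ?_
      push_cast
      ring
    have h := integral_Ioi_of_hasDerivAt_of_tendsto' hd (hf'2.add (hfr.const_mul 2))
      (tendsto_mul_pow_atTop_zero hR 2 hderiv hf'0 hf'2 hlim)
    rw [integral_add hf'2 (hfr.const_mul 2), integral_const_mul] at h
    linarith
  simp only [integral_sub_sq_mul_pow_six hR hf'0 hf'2 hint, hI0, hI2]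
  set N := ∫ r in Ioi R, f' r ^ 2 * r ^ 6
  set I := ∫ r in Ioi R, f r * r
  set V := N - 5 * f R ^ 2 * R ^ 5 - R * (3 * I - f R * R ^ 2) ^ 2 with hV
  -- Complete the square in the coefficients.
  have hsq : ∀ c d : ℝ, N + 10 * c * -f R + 6 * d * (-(f R * R ^ 2) - 2 * I) +
      5 * c ^ 2 / R ^ 5 + 10 * c * d / R ^ 3 + 9 * d ^ 2 / R =
      V + 5 / R ^ 5 * (c + R ^ 2 * d - R ^ 5 * f R) ^ 2 +
        4 / R * (d - R * (3 * I - f R * R ^ 2) / 2) ^ 2 := by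
    intro c d
    rw [hV]
    field_simp
    ring
  simp only [hsq]
  have hle : ∀ c : ℝ × ℝ, V ≤ V + 5 / R ^ 5 * (c.1 + R ^ 2 * c.2 - R ^ 5 * f R) ^ 2 +
      4 / R * (c.2 - R * (3 * I - f R * R ^ 2) / 2) ^ 2 := by
    intro c
    rw [add_assoc]
    exact le_add_of_nonneg_right (by positivity)
  refine le_antisymm ?_ (le_ciInf hle)
  set d := R * (3 * I - f R * R ^ 2) / 2
  refine (ciInf_le ⟨V, forall_mem_range.2 hle⟩ (R ^ 5 * f R - R ^ 2 * d, d)).trans_eq ?_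
  ring
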